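/- arXiv:1711.09826 — 4 statements merged into one kernel-verified Lean document; each statement's English description precedes it below -/
import Mathlib

section
/- Let 0 < μ ≤ λ be real numbers and let t* > 0 be the unique solution of e^{−λt} + e^{−μt} = 1. Then t* ≤ 3 · log(eλ/μ) / λ. -/
/-- **Upper bound for the critical time.** If `0 < mu ≤ lam` and `t > 0` solves
`e^{-lam t} + e^{-mu t} = 1`, then `t ≤ 3 · log(e·lam/mu) / lam`. -/
theorem critical_time_upper_bound (mu lam t : ℝ) (hmu : 0 < mu) (hle : mu ≤ lam)
    (ht : 0 < t) (heq : Real.exp (-lam * t) + Real.exp (-mu * t) = 1) :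
    t ≤ 3 * Real.log (Real.exp 1 * lam / mu) / lam := by
  have hlam : 0 < lam := hmu.trans_le hle
  have he : 2 ≤ Real.exp 1 := by linarith [Real.add_one_le_exp 1]
  have hpos : 0 < Real.exp 1 * lam / mu := by positivity
  have hlog : 1 ≤ Real.log (Real.exp 1 * lam / mu) := by
    rw [Real.le_log_iff_exp_le hpos, le_div_iff₀ hmu]
    gcongr
  rw [le_div_iff₀ hlam]
  by_contra! hlt
  have hE : Real.exp 1 * lam ≤ Real.exp (lam * t) * mu := by
    rw [← div_le_iff₀ hmu, ← Real.log_le_iff_le_exp hpos]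
    linarith
  have hprod : (Real.exp (lam * t) - 1) * (Real.exp (mu * t) - 1) = 1 := by
    rw [neg_mul, neg_mul, Real.exp_neg, Real.exp_neg] at heq
    field_simp at heq
    rw [mul_comm t mu] at heq
    linarith
  have hE1 : 0 ≤ Real.exp (lam * t) - 1 :=
    sub_nonneg.2 (Real.one_le_exp (by positivity))
  have hF : mu * t ≤ Real.exp (mu * t) - 1 := by linarith [Real.add_one_le_exp (mu * t)]
  have hbound := mul_le_mul_of_nonneg_left hF hE1
  have hmul := mul_le_mul_of_nonneg_right hE ht.le
  have htwo := mul_le_mul_of_nonneg_right he (mul_pos hlam ht).le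
  have hmt := mul_le_mul_of_nonneg_right hle ht.le
  linarith
end

section
/- Let 0 < μ ≤ λ/50. Then the unique solution t* > 0 of e^{−λt} + e^{−μt} = 1 satisfies t* ≤ log(eλ/μ) / λ. -/
/-- The value at `log (e * r) = 1 + log r` of `s ↦ e^{-s} + e^{-s/r}` is at most `1`. -/
theorem exp_neg_one_add_log_add_exp_neg_div_le_one {r : ℝ} (hr : 1 ≤ r) :
    Real.exp (-(1 + Real.log r)) + Real.exp (-((1 + Real.log r) / r)) ≤ 1 := by
  have hr0 : 0 < r := by linarith
  have hlog : Real.log r ≤ r - 1 := Real.log_le_sub_one_of_pos hr0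
  have hlog0 : 0 ≤ Real.log r := Real.log_nonneg hr
  have hx1 : (1 + Real.log r) / r ≤ 1 := (div_le_one hr0).2 (by linarith)
  have hrx : 1 / r ≤ (1 + Real.log r) / r := by gcongr; linarith
  have hr' : 0 < 1 / r := by positivity
  have hfst : Real.exp (-(1 + Real.log r)) ≤ 1 / r / 2 := by
    rw [Real.exp_neg, Real.exp_add, Real.exp_log hr0, div_div, ← one_div]
    have he : 2 ≤ Real.exp 1 := by linarith [Real.add_one_le_exp 1]
    exact one_div_le_one_div_of_le (by positivity) (by nlinarith)
  generalize (1 + Real.log r) / r = x at *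
  have hsnd : Real.exp (-x) ≤ 1 - x / 2 := by
    have hx : 0 < x + 1 := by linarith
    calc Real.exp (-x) ≤ (x + 1)⁻¹ := by
          rw [Real.exp_neg]
          exact inv_anti₀ hx (Real.add_one_le_exp x)
      _ ≤ 1 - x / 2 := by
          rw [inv_le_iff_one_le_mul₀ hx]
          nlinarith
  linarith

/-- **Sharper upper bound for the critical time when `mu ≤ lam/50`.** If `0 < mu ≤ lam/50`
and `t > 0` solves `e^{-lam t} + e^{-mu t} = 1`, then `t ≤ log(e·lam/mu) / lam`. -/
theorem critical_time_upper_bound_small_mu (mu lam t : ℝ) (hmu : 0 < mu)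
    (hle : mu ≤ lam / 50)
    (ht : 0 < t) (heq : Real.exp (-lam * t) + Real.exp (-mu * t) = 1) :
    t ≤ Real.log (Real.exp 1 * lam / mu) / lam := by
  have hlam : 0 < lam := by linarith
  have hr : 1 ≤ lam / mu := (one_le_div hmu).2 (by linarith)
  have hlog : Real.log (Real.exp 1 * lam / mu) = 1 + Real.log (lam / mu) := by
    rw [mul_div_assoc, Real.log_mul (Real.exp_ne_zero 1) (by positivity), Real.log_exp]
  have key := exp_neg_one_add_log_add_exp_neg_div_le_one hr
  rw [hlog]
  by_contra! hlt
  rw [div_lt_iff₀ hlam] at hlt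
  have hfst : Real.exp (-lam * t) < Real.exp (-(1 + Real.log (lam / mu))) :=
    Real.exp_lt_exp.2 (by linarith)
  have hsnd : Real.exp (-mu * t) < Real.exp (-((1 + Real.log (lam / mu)) / (lam / mu))) := by
    refine Real.exp_lt_exp.2 ?_
    rw [neg_mul, neg_lt_neg_iff, div_lt_iff₀ (by positivity)]
    have : mu * t * (lam / mu) = t * lam := by field_simp
    rwa [this]
  linarith
end

section
/- For every real x with 0 < x < e, one has (ex)^{0.8} + (ex)^{0.8x} ≥ 1, where e is Euler's number and powers are real powers of the positive base ex. -/
theorem mul_exp_neg_le_exp_neg (s : ℝ) :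
    0.8 * s * Real.exp (-s - 1) ≤ Real.exp (-(0.8 * s)) := by
  have h2 : (2 : ℝ) ≤ Real.exp 1 := by linarith [Real.add_one_le_exp (1 : ℝ)]
  have h3 : 0.2 * s ≤ Real.exp (0.2 * s - 1) := by
    linarith [Real.add_one_le_exp (0.2 * s - 1)]
  have h4 : 0.8 * s ≤ Real.exp (0.2 * s + 1) := by
    have h5 : Real.exp (0.2 * s + 1) = Real.exp (0.2 * s - 1) * (Real.exp 1 * Real.exp 1) := by
      rw [← Real.exp_add, ← Real.exp_add]
      ring_nf
    rw [h5]
    calc 0.8 * s = 0.2 * s * (2 * 2) := by ring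
      _ ≤ _ := by gcongr
  calc 0.8 * s * Real.exp (-s - 1) ≤ Real.exp (0.2 * s + 1) * Real.exp (-s - 1) := by gcongr
    _ = Real.exp (-(0.8 * s)) := by
      rw [← Real.exp_add]
      ring_nf

/-- For `0 < x < e` one has `(ex)^{0.8} + (ex)^{0.8x} ≥ 1` (real powers). -/
theorem rpow_point_eight_inequality (x : ℝ) (h0 : 0 < x) (h1 : x < Real.exp 1) :
    1 ≤ (Real.exp 1 * x) ^ (0.8 : ℝ) + (Real.exp 1 * x) ^ (0.8 * x) := by
  have hu : 0 < Real.exp 1 * x := by positivity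
  have hlog : Real.log (Real.exp 1 * x) = 1 + Real.log x := by
    rw [Real.log_mul (Real.exp_pos 1).ne' h0.ne', Real.log_exp]
  have key := mul_exp_neg_le_exp_neg (-(1 + Real.log x))
  rw [show -(-(1 + Real.log x)) - 1 = Real.log x by ring, Real.exp_log h0,
    show -(0.8 * -(1 + Real.log x)) = (1 + Real.log x) * 0.8 by ring] at key
  rw [Real.rpow_def_of_pos hu, Real.rpow_def_of_pos hu, hlog]
  linarith [Real.add_one_le_exp ((1 + Real.log x) * (0.8 * x))]
end

section
/- For every real x with 0 < x < 0.02, one has (ex) + (ex)^{x} < 1, where e is Euler's number and the power is a real power of the positive base ex. -/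
lemma log_exp_one_mul_lt {x : ℝ} (h0 : 0 < x) (h1 : x < 0.02) :
    Real.log (Real.exp 1 * x) < -2.9 := by
  have hlog : Real.log x < -3.9 := by
    have h50 : Real.exp 3.9 < 50 := by
      refine lt_of_pow_lt_pow_left₀ 10 (by norm_num) ?_
      have h : Real.exp 3.9 ^ 10 = Real.exp 1 ^ 39 := by
        rw [← Real.exp_nat_mul, ← Real.exp_nat_mul]
        norm_num
      rw [h]
      calc Real.exp 1 ^ 39 < 2.7182818286 ^ 39 := by
            gcongr
            exact Real.exp_one_lt_d9
        _ < 50 ^ 10 := by norm_num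
    rw [Real.log_lt_iff_lt_exp h0, Real.exp_neg]
    have : (50 : ℝ)⁻¹ < (Real.exp 3.9)⁻¹ := by gcongr
    norm_num at *
    linarith
  rw [Real.log_mul (Real.exp_pos 1).ne' h0.ne', Real.log_exp]
  linarith

/-- For `0 < x < 0.02` one has `(ex) + (ex)^x < 1` (real power). -/
theorem rpow_small_x_inequality (x : ℝ) (h0 : 0 < x) (h1 : x < 0.02) :
    Real.exp 1 * x + (Real.exp 1 * x) ^ x < 1 := by
  have hlog := log_exp_one_mul_lt h0 h1
  have he := Real.exp_one_lt_d9
  rw [Real.rpow_def_of_pos (by positivity)]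
  set L := -Real.log (Real.exp 1 * x) with hL
  have hLog : Real.log (Real.exp 1 * x) * x = -(x * L) := by rw [hL]; ring
  have hL' : 2.9 < L := by linarith
  rw [hLog]
  have hu : Real.exp 1 * x < 0.0544 := by nlinarith
  have hp : Real.exp (-(x * L)) * (1 + x * L) ≤ 1 := by
    rw [Real.exp_neg, inv_mul_le_one₀ (Real.exp_pos _)]
    linarith [Real.add_one_le_exp (x * L)]
  have hgap : Real.exp 1 < (1 - Real.exp 1 * x) * L := by nlinarith
  have hxL : 0 < 1 + x * L := by positivity
  by_contra! hge
  have hmul : (1 - Real.exp 1 * x) * (1 + x * L) ≤ 1 :=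
    (mul_le_mul_of_nonneg_right (by linarith) hxL.le).trans hp
  nlinarith [mul_lt_mul_of_pos_left hgap h0]
end
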